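/- arXiv:1911.06666 — 3 statements merged into one kernel-verified Lean document; each statement's English description precedes it below -/
import Mathlib

section
/- In Ỹ (with higher modes defined by the recursion in the context), for all i,j ∈ I and all r ∈ ℤ_{≥0}: (1) [h_{i,0}, x^±_{j,r}] = ±a_{i,j} x^±_{j,r}; and (2) [h̃_{i,1}, x^±_{j,r}] = ±a_{i,j}( x^±_{j,r+1} − b_{i,j}((ε₁−ε₂)/2) x^±_{j,r} ). -/
noncomputable section

open scoped BigOperators

/-- The parity function `p` on indices, realized on `ZMod (m+n)`:
`p(i) = 0` for `1 ≤ i ≤ m` and `p(i) = 1` otherwise (so `p(0) = 1`). -/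
def ppar (m n : ℕ) (i : ZMod (m + n)) : ℕ :=
  if 1 ≤ i.val ∧ i.val ≤ m then 0 else 1

/-- Parity of the generators `x^±_{i,r}`: they are odd exactly when `i = 0` or `i = m`. -/
def gpar (m n : ℕ) (i : ZMod (m + n)) : ℕ := (ppar m n i + ppar m n (i + 1)) % 2

/-- The integer valued Cartan matrix `a_{i,j}` of `\hat{sl}(m|n)`.
The cyclic cases `(0, m+n-1)` and `(m+n-1, 0)` are covered by the clauses
`j = i - 1` and `j = i + 1` in `ZMod (m+n)`. -/
def aZ (m n : ℕ) (i j : ZMod (m + n)) : ℤ :=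
  if i = j then (-1) ^ ppar m n i + (-1) ^ ppar m n (i + 1)
  else if j = i + 1 then -(-1) ^ ppar m n (i + 1)
  else if j = i - 1 then -(-1) ^ ppar m n i
  else 0

/-- `a_{i,j}` as a complex number. -/
def aC (m n : ℕ) (i j : ZMod (m + n)) : ℂ := (aZ m n i j : ℂ)

/-- The matrix `b_{i,j}`. -/
def bC (m n : ℕ) (i j : ZMod (m + n)) : ℂ :=
  if i = ((m + n - 1 : ℕ) : ZMod (m + n)) ∧ j = 0 then 1
  else if i = j + 1 then -(-1) ^ ppar m n (i + 1)
  else if i = j - 1 then (-1) ^ ppar m n i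
  else 0

variable {A : Type*} [Ring A] [Algebra ℂ A]

/-- The supercommutator `[x,y] = xy - (-1)^{p(x)p(y)} yx` of elements of parities `px`, `py`. -/
def sbr (px py : ℕ) (x y : A) : A := x * y - ((-1 : ℂ) ^ (px * py)) • (y * x)

/-- The anticommutator `{x,y} = xy + yx`. -/
def acm (x y : A) : A := x * y + y * x

/-- The sign `±1` governing the `x^+`/`x^-` cases. -/
def sgn (b : Bool) : ℂ := if b then 1 else -1

/-- Iterated super-adjoint action `(ad x)^k y`, where `x` has parity `px` and `y` parity `py`. -/
def adPow (px : ℕ) (x : A) (py : ℕ) (y : A) : ℕ → A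
  | 0 => y
  | k + 1 => sbr px ((py + k * px) % 2) x (adPow px x py y k)

/-- Nested supercommutator `[g 0, [g 1, … , [g (k-1), y] … ]]` where every `g l`
has parity `px` and `y` has parity `py`. -/
def serreNest (px py : ℕ) : (k : ℕ) → (Fin k → A) → A → A
  | 0, _, y => y
  | k + 1, g, y => sbr px ((py + k * px) % 2) (g 0) (serreNest px py k (fun l => g l.succ) y)

/-- `h̃_{i,1} = h_{i,1} - ((ε₁+ε₂)/2) h_{i,0}²`. -/
def htld (m n : ℕ) (ε₁ ε₂ : ℂ) (H : ZMod (m + n) → ℕ → A) (i : ZMod (m + n)) : A :=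
  H i 1 - ((ε₁ + ε₂) / 2) • (H i 0 * H i 0)

/-- A representation of the minimalistic presentation `Ỹ` of the affine super Yangian
`Y_{ε₁,ε₂}(ŝl(m|n))`: elements `x^±_{i,r}`, `h_{i,r}` of an associative `ℂ`-algebra
satisfying the defining relations (2.1)–(2.9) for the modes `r ∈ {0,1}`, together with
the recursive definition of the higher modes `r ≥ 2`. -/
structure YtildeRep (m n : ℕ) (ε₁ ε₂ : ℂ) (A : Type*) [Ring A] [Algebra ℂ A] where
  /-- `x^+_{i,r}` (`b = true`) and `x^-_{i,r}` (`b = false`). -/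
  X : Bool → ZMod (m + n) → ℕ → A
  /-- `h_{i,r}`. -/
  H : ZMod (m + n) → ℕ → A
  rel21 : ∀ (i j : ZMod (m + n)) (r s : ℕ), r ≤ 1 → s ≤ 1 → H i r * H j s = H j s * H i r
  rel22 : ∀ i j : ZMod (m + n),
      sbr (gpar m n i) (gpar m n j) (X true i 0) (X false j 0) = if i = j then H i 0 else 0
  rel23a : ∀ i j : ZMod (m + n),
      sbr (gpar m n i) (gpar m n j) (X true i 1) (X false j 0) = if i = j then H i 1 else 0
  rel23b : ∀ i j : ZMod (m + n),
      sbr (gpar m n i) (gpar m n j) (X true i 0) (X false j 1) = if i = j then H i 1 else 0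
  rel24 : ∀ (b : Bool) (i j : ZMod (m + n)) (r : ℕ), r ≤ 1 →
      H i 0 * X b j r - X b j r * H i 0 = (sgn b * aC m n i j) • X b j r
  rel25 : ∀ (b : Bool) (i j : ZMod (m + n)),
      htld m n ε₁ ε₂ H i * X b j 0 - X b j 0 * htld m n ε₁ ε₂ H i
        = (sgn b * aC m n i j) • (X b j 1 - (bC m n i j * ((ε₁ - ε₂) / 2)) • X b j 0)
  rel26 : ∀ (b : Bool) (i j : ZMod (m + n)),
      sbr (gpar m n i) (gpar m n j) (X b i 1) (X b j 0)
          - sbr (gpar m n i) (gpar m n j) (X b i 0) (X b j 1)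
        = (sgn b * aC m n i j * ((ε₁ + ε₂) / 2)) • acm (X b i 0) (X b j 0)
          - (bC m n i j * ((ε₁ - ε₂) / 2)) •
              sbr (gpar m n i) (gpar m n j) (X b i 0) (X b j 0)
  rel27 : ∀ (b : Bool) (i j : ZMod (m + n)), i ≠ j →
      adPow (gpar m n i) (X b i 0) (gpar m n j) (X b j 0) (1 + (aZ m n i j).natAbs) = 0
  rel28 : ∀ (b : Bool) (i : ZMod (m + n)), i = 0 ∨ i = (m : ZMod (m + n)) →
      sbr (gpar m n i) (gpar m n i) (X b i 0) (X b i 0) = 0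
  rel29 : ∀ (b : Bool) (i : ZMod (m + n)), i = 0 ∨ i = (m : ZMod (m + n)) →
      sbr ((gpar m n (i - 1) + gpar m n i) % 2) ((gpar m n i + gpar m n (i + 1)) % 2)
        (sbr (gpar m n (i - 1)) (gpar m n i) (X b (i - 1) 0) (X b i 0))
        (sbr (gpar m n i) (gpar m n (i + 1)) (X b i 0) (X b (i + 1) 0)) = 0
  recX : ∀ (b : Bool) (i : ZMod (m + n)) (r : ℕ), 1 ≤ r →
      X b i (r + 1) =
        if i = 0 ∨ i = (m : ZMod (m + n)) then
          (sgn b * (aC m n (i + 1) i)⁻¹) •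
              (htld m n ε₁ ε₂ H (i + 1) * X b i r - X b i r * htld m n ε₁ ε₂ H (i + 1))
            + (bC m n (i + 1) i * ((ε₁ - ε₂) / 2)) • X b i r
        else
          (sgn b * (aC m n i i)⁻¹) •
            (htld m n ε₁ ε₂ H i * X b i r - X b i r * htld m n ε₁ ε₂ H i)
  recH : ∀ (i : ZMod (m + n)) (r : ℕ), 1 ≤ r →
      H i (r + 1) = sbr (gpar m n i) (gpar m n i) (X true i (r + 1)) (X false i 0)


/-- If a sequence is generated by a linear combination of `ad t` and the identity, then the action
of `ad u`, for any `u` commuting with `t`, has the same form on every term as on the first one. -/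
theorem commutator_eq_of_recursion {t u : A} (htu : t * u = u * t) {x : ℕ → A} {γ δ p q : ℂ}
    (hx : ∀ r, x (r + 1) = γ • (t * x r - x r * t) + δ • x r)
    (h₀ : u * x 0 - x 0 * u = p • x 1 + q • x 0) (r : ℕ) :
    u * x r - x r * u = p • x (r + 1) + q • x r := by
  induction r with
  | zero => exact h₀
  | succ r ih =>
    have jacobi : u * (t * x r - x r * t) - (t * x r - x r * t) * u
        = t * (u * x r - x r * u) - (u * x r - x r * u) * t := by
      have h₁ : u * (t * x r) = t * (u * x r) := by rw [← mul_assoc, ← htu, mul_assoc]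
      have h₂ : x r * t * u = x r * u * t := by rw [mul_assoc, htu, mul_assoc]
      simp only [mul_sub, sub_mul, h₁, h₂, mul_assoc]
      abel
    calc u * x (r + 1) - x (r + 1) * u
        = γ • (u * (t * x r - x r * t) - (t * x r - x r * t) * u)
            + δ • (u * x r - x r * u) := by
          rw [hx r]
          simp only [mul_add, add_mul, mul_smul_comm, smul_mul_assoc]
          module
      _ = γ • (t * (p • x (r + 1) + q • x r) - (p • x (r + 1) + q • x r) * t)
            + δ • (p • x (r + 1) + q • x r) := by rw [jacobi, ih]
      _ = p • (γ • (t * x (r + 1) - x (r + 1) * t) + δ • x (r + 1))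
            + q • (γ • (t * x r - x r * t) + δ • x r) := by
          simp only [mul_add, add_mul, mul_smul_comm, smul_mul_assoc]
          module
      _ = p • x (r + 1 + 1) + q • x (r + 1) := by rw [← hx, ← hx]

theorem sgn_mul_self (b : Bool) : sgn b * sgn b = 1 := by
  cases b <;> simp [sgn]

theorem natCast_ne_zero_of_lt {m n k : ℕ} (hk : 0 < k) (hlt : k < m + n) :
    ((k : ℕ) : ZMod (m + n)) ≠ 0 := by
  rw [Ne, ZMod.natCast_eq_zero_iff]
  exact Nat.not_dvd_of_pos_of_lt hk hlt

theorem ppar_add_one {m n : ℕ} (hm : 2 ≤ m) (hn : 2 ≤ n) {j : ZMod (m + n)}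
    (h0 : j ≠ 0) (hjm : j ≠ (m : ZMod (m + n))) : ppar m n (j + 1) = ppar m n j := by
  have : NeZero (m + n) := ⟨by omega⟩
  have : Fact (1 < m + n) := ⟨by omega⟩
  have hv0 : j.val ≠ 0 := by rwa [Ne, ZMod.val_eq_zero]
  have hvm : j.val ≠ m := by
    intro h
    exact hjm ((ZMod.natCast_zmod_val j).symm.trans (congrArg Nat.cast h))
  have hlt := ZMod.val_lt j
  have hval : (j + 1).val = (j.val + 1) % (m + n) := by
    rw [ZMod.val_add, ZMod.val_one]
  rcases Nat.lt_or_ge (j.val + 1) (m + n) with h | h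
  · rw [Nat.mod_eq_of_lt h] at hval
    simp only [ppar, hval]
    congr 1
    apply propext
    omega
  · have h' : j.val + 1 = m + n := by omega
    rw [h', Nat.mod_self] at hval
    simp only [ppar, hval]
    congr 1
    apply propext
    omega

theorem aC_self_ne_zero {m n : ℕ} (hm : 2 ≤ m) (hn : 2 ≤ n) {j : ZMod (m + n)}
    (h0 : j ≠ 0) (hjm : j ≠ (m : ZMod (m + n))) : aC m n j j ≠ 0 := by
  rw [aC, aZ, if_pos rfl, ppar_add_one hm hn h0 hjm, Int.cast_ne_zero, ← two_mul]
  exact mul_ne_zero two_ne_zero (pow_ne_zero _ (by norm_num))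

theorem aC_add_one_ne_zero {m n : ℕ} (hm : 2 ≤ m) (hn : 2 ≤ n) (j : ZMod (m + n)) :
    aC m n (j + 1) j ≠ 0 := by
  have h1 : (1 : ZMod (m + n)) ≠ 0 := by
    simpa using natCast_ne_zero_of_lt (m := m) (n := n) one_pos (by omega)
  have h2 : (1 + 1 : ZMod (m + n)) ≠ 0 := by
    simpa [one_add_one_eq_two] using natCast_ne_zero_of_lt (m := m) (n := n) two_pos (by omega)
  have hne : ¬ j + 1 = j := by simpa using h1
  have hne' : ¬ j = j + 1 + 1 := by
    rw [add_assoc]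
    simpa using h2
  rw [aC, aZ, if_neg hne, if_neg hne', if_pos (by ring), Int.cast_ne_zero]
  exact neg_ne_zero.mpr (pow_ne_zero _ (by norm_num))

theorem bC_self {m n : ℕ} (hm : 2 ≤ m) (hn : 2 ≤ n) (j : ZMod (m + n)) : bC m n j j = 0 := by
  have h1 : (1 : ZMod (m + n)) ≠ 0 := by
    simpa using natCast_ne_zero_of_lt (m := m) (n := n) one_pos (by omega)
  have hlast : ((m + n - 1 : ℕ) : ZMod (m + n)) ≠ 0 :=
    natCast_ne_zero_of_lt (by omega) (by omega)
  have hcorner : ¬ (j = ((m + n - 1 : ℕ) : ZMod (m + n)) ∧ j = 0) := by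
    rintro ⟨h, h'⟩
    exact hlast (h.symm.trans h')
  have hsucc : ¬ j = j + 1 := by simpa using h1
  have hpred : ¬ j = j - 1 := by
    rw [eq_comm, sub_eq_self]
    exact h1
  rw [bC, if_neg hcorner, if_neg hsucc, if_neg hpred]

namespace YtildeRep

variable {m n : ℕ} {ε₁ ε₂ : ℂ} (R : YtildeRep m n ε₁ ε₂ A)

theorem commute_H {r s : ℕ} (i j : ZMod (m + n)) (hr : r ≤ 1) (hs : s ≤ 1) :
    Commute (R.H i r) (R.H j s) :=
  R.rel21 i j r s hr hs

theorem commute_htld_H_zero (i j : ZMod (m + n)) :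
    Commute (htld m n ε₁ ε₂ R.H i) (R.H j 0) :=
  (R.commute_H i j le_rfl zero_le_one).sub_left
    (((R.commute_H i j zero_le_one zero_le_one).mul_left
      (R.commute_H i j zero_le_one zero_le_one)).smul_left _)

theorem commute_htld (i j : ZMod (m + n)) :
    Commute (htld m n ε₁ ε₂ R.H i) (htld m n ε₁ ε₂ R.H j) := by
  have h₁ : Commute (htld m n ε₁ ε₂ R.H i) (R.H j 1) :=
    (R.commute_H i j le_rfl le_rfl).sub_left
      (((R.commute_H i j zero_le_one le_rfl).mul_left
        (R.commute_H i j zero_le_one le_rfl)).smul_left _)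
  exact h₁.sub_right
    (((R.commute_htld_H_zero i j).mul_right (R.commute_htld_H_zero i j)).smul_right _)

theorem X_one_eq (b : Bool) {k j : ZMod (m + n)} (ha : aC m n k j ≠ 0) :
    R.X b j 1 = (sgn b * (aC m n k j)⁻¹) •
        (htld m n ε₁ ε₂ R.H k * R.X b j 0 - R.X b j 0 * htld m n ε₁ ε₂ R.H k)
      + (bC m n k j * ((ε₁ - ε₂) / 2)) • R.X b j 0 := by
  have hc : sgn b * (aC m n k j)⁻¹ * (sgn b * aC m n k j) = 1 := by
    rw [mul_mul_mul_comm, sgn_mul_self, inv_mul_cancel₀ ha, one_mul]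
  rw [R.rel25, smul_smul, hc, one_smul, sub_add_cancel]

/-- The recursion for the higher modes holds from mode `0` on, for a suitable index `k`. -/
theorem exists_X_succ_eq (hm : 2 ≤ m) (hn : 2 ≤ n) (b : Bool) (j : ZMod (m + n)) :
    ∃ (k : ZMod (m + n)) (γ δ : ℂ), ∀ r, R.X b j (r + 1) =
      γ • (htld m n ε₁ ε₂ R.H k * R.X b j r - R.X b j r * htld m n ε₁ ε₂ R.H k)
        + δ • R.X b j r := by
  by_cases hj : j = 0 ∨ j = (m : ZMod (m + n))
  · refine ⟨j + 1, sgn b * (aC m n (j + 1) j)⁻¹, bC m n (j + 1) j * ((ε₁ - ε₂) / 2), ?_⟩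
    rintro (_ | r)
    · exact R.X_one_eq b (aC_add_one_ne_zero hm hn j)
    · rw [R.recX b j (r + 1) (by omega), if_pos hj]
  · refine ⟨j, sgn b * (aC m n j j)⁻¹, bC m n j j * ((ε₁ - ε₂) / 2), ?_⟩
    rintro (_ | r)
    · exact R.X_one_eq b
        (aC_self_ne_zero hm hn (fun h => hj (Or.inl h)) (fun h => hj (Or.inr h)))
    · rw [R.recX b j (r + 1) (by omega), if_neg hj, bC_self hm hn, zero_mul, zero_smul, add_zero]

end YtildeRep

/-- in `Ỹ`, for all `i, j ∈ I` and all `r ≥ 0`,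
`[h_{i,0}, x^±_{j,r}] = ± a_{i,j} x^±_{j,r}` and
`[h̃_{i,1}, x^±_{j,r}] = ± a_{i,j}(x^±_{j,r+1} - b_{i,j}((ε₁-ε₂)/2) x^±_{j,r})`. -/
theorem affine_super_yangian_stmt4
    (m n : ℕ) (hm : 2 ≤ m) (hn : 2 ≤ n) (hmn : m ≠ n) (ε₁ ε₂ : ℂ)
    (B : Type*) [Ring B] [Algebra ℂ B] (R : YtildeRep m n ε₁ ε₂ B)
    (b : Bool) (i j : ZMod (m + n)) (r : ℕ) :
    (R.H i 0 * R.X b j r - R.X b j r * R.H i 0 = (sgn b * aC m n i j) • R.X b j r) ∧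
    (htld m n ε₁ ε₂ R.H i * R.X b j r - R.X b j r * htld m n ε₁ ε₂ R.H i
      = (sgn b * aC m n i j) •
          (R.X b j (r + 1) - (bC m n i j * ((ε₁ - ε₂) / 2)) • R.X b j r)) := by
  obtain ⟨k, γ, δ, hX⟩ := R.exists_X_succ_eq hm hn b j
  constructor
  · have h := commutator_eq_of_recursion (R.commute_htld_H_zero k i) hX
      (p := 0) (q := sgn b * aC m n i j)
      (by rw [R.rel24 b i j 0 zero_le_one, zero_smul, zero_add]) r
    rwa [zero_smul, zero_add] at h
  · have h := commutator_eq_of_recursion (R.commute_htld k i) hX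
      (p := sgn b * aC m n i j)
      (q := -(sgn b * aC m n i j * (bC m n i j * ((ε₁ - ε₂) / 2))))
      (by rw [R.rel25 b i j]; module) r
    rw [h]
    module

end
end

section
/- In Ỹ (with higher modes defined by the recursion in the context), [h_{i,2}, h_{j,0}] = 0 for all i,j ∈ I. -/
noncomputable section

open scoped BigOperators

variable {A : Type*} [Ring A] [Algebra ℂ A]

/-- Weights of `ad h` add under multiplication. -/
theorem ad_weight_mul {B : Type*} [Ring B] [Algebra ℂ B] {h x y : B} {c d : ℂ}
    (hx : h * x - x * h = c • x) (hy : h * y - y * h = d • y) :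
    h * (x * y) - x * y * h = (c + d) • (x * y) := by
  calc h * (x * y) - x * y * h = (h * x - x * h) * y + x * (h * y - y * h) := by noncomm_ring
    _ = (c + d) • (x * y) := by rw [hx, hy, smul_mul_assoc, mul_smul_comm, add_smul]

/-- A linear combination of elements of weight `c` for `ad h` has weight `c`. -/
theorem ad_weight_smul_add_smul {B : Type*} [Ring B] [Algebra ℂ B] {h x y : B} {c : ℂ}
    (hx : h * x - x * h = c • x) (hy : h * y - y * h = c • y) (a b : ℂ) :
    h * (a • x + b • y) - (a • x + b • y) * h = c • (a • x + b • y) := by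
  calc h * (a • x + b • y) - (a • x + b • y) * h
      = a • (h * x - x * h) + b • (h * y - y * h) := by
        simp only [mul_add, add_mul, mul_smul_comm, smul_mul_assoc, smul_sub]; abel
    _ = c • (a • x + b • y) := by
        rw [hx, hy, smul_add, smul_comm a c, smul_comm b c]

/-- If `t` commutes with `h`, then `ad t` preserves the weight spaces of `ad h`. -/
theorem ad_weight_commutator {B : Type*} [Ring B] [Algebra ℂ B] {h t x : B} {c : ℂ}
    (ht : Commute h t) (hx : h * x - x * h = c • x) :
    h * (t * x - x * t) - (t * x - x * t) * h = c • (t * x - x * t) := by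
  have h0 : h * t - t * h = (0 : ℂ) • t := by rw [ht.eq, sub_self, zero_smul]
  have h1 := ad_weight_mul h0 hx
  have h2 := ad_weight_mul hx h0
  rw [zero_add] at h1
  rw [add_zero] at h2
  simpa [sub_eq_add_neg] using ad_weight_smul_add_smul h1 h2 1 (-1)

/-- `h_{j,0}` commutes with `h̃_{k,1}`. -/
theorem YtildeRep.commute_htld_s7 {m n : ℕ} {ε₁ ε₂ : ℂ} {B : Type*} [Ring B] [Algebra ℂ B]
    (R : YtildeRep m n ε₁ ε₂ B) (j k : ZMod (m + n)) :
    Commute (R.H j 0) (htld m n ε₁ ε₂ R.H k) := by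
  have h0 : Commute (R.H j 0) (R.H k 0) := R.rel21 j k 0 0 (by simp) (by simp)
  have h1 : Commute (R.H j 0) (R.H k 1) := R.rel21 j k 0 1 (by simp) le_rfl
  exact h1.sub_right ((h0.mul_right h0).smul_right _)

/-- Every `x^±_{i,r}` has weight `±a_{j,i}` for `ad h_{j,0}`. -/
theorem YtildeRep.ad_weight_X {m n : ℕ} {ε₁ ε₂ : ℂ} {B : Type*} [Ring B] [Algebra ℂ B]
    (R : YtildeRep m n ε₁ ε₂ B) (b : Bool) (i j : ZMod (m + n)) (r : ℕ) :
    R.H j 0 * R.X b i r - R.X b i r * R.H j 0 = (sgn b * aC m n j i) • R.X b i r := by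
  induction r with
  | zero => exact R.rel24 b j i 0 zero_le_one
  | succ r ih =>
    rcases Nat.eq_zero_or_pos r with rfl | hr
    · exact R.rel24 b j i 1 le_rfl
    rw [R.recX b i r hr]
    split_ifs
    · exact ad_weight_smul_add_smul (ad_weight_commutator (R.commute_htld_s7 j _) ih) ih _ _
    · simpa using ad_weight_smul_add_smul (ad_weight_commutator (R.commute_htld_s7 j i) ih) ih
        (sgn b * (aC m n i i)⁻¹) 0

/-- `[h_{i,2}, h_{j,0}] = 0` in `Ỹ`. -/
theorem affine_super_yangian_stmt7
    (m n : ℕ) (hm : 2 ≤ m) (hn : 2 ≤ n) (hmn : m ≠ n) (ε₁ ε₂ : ℂ)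
    (B : Type*) [Ring B] [Algebra ℂ B] (R : YtildeRep m n ε₁ ε₂ B)
    (i j : ZMod (m + n)) :
    R.H i 2 * R.H j 0 = R.H j 0 * R.H i 2 := by
  have hp := R.ad_weight_X true i j 2
  have hq := R.ad_weight_X false i j 0
  have hc : sgn true * aC m n j i + sgn false * aC m n j i = 0 := by simp [sgn]
  have h1 := ad_weight_mul hp hq
  have h2 := ad_weight_mul hq hp
  rw [hc, zero_smul, sub_eq_zero] at h1
  rw [add_comm, hc, zero_smul, sub_eq_zero] at h2
  rw [R.recH i 1 le_rfl, sbr, mul_sub, sub_mul, mul_smul_comm, smul_mul_assoc, h1, h2]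

end
end

section
/- In Ỹ (with higher modes defined by the recursion in the context), if i,j ∈ I satisfy either (a_{i,i} = 2 and a_{i,j} = −1) or (a_{i,i} = −2 and a_{i,j} = 1), then [h_{i,2}, h_{i,1}] = 0. -/
noncomputable section

open scoped BigOperators

variable {A : Type*} [Ring A] [Algebra ℂ A]

/-- The modes `u`, `v` of one node (with Cartan elements `h₀`, `h₁`, `t` standing for `h_{i,0}`,
`h_{i,1}`, `h̃_{i,1}`) coupled with the modes `y`, `z` of an adjacent node, whose first Cartan
mode is `g`. The scalars `σ`, `τ` are the signs of the brackets within each node. -/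
structure CoupledModes (σ τ a β θ κ : ℂ) (t h₀ h₁ g : A) (u v y z : ℕ → A) : Prop where
  h₁_eq : h₁ = t + κ • (h₀ * h₀) + θ • h₀
  t_y : ∀ r, t * y r - y r * t = a • y (r + 1) + β • y r
  t_z : ∀ r, t * z r - z r * t = -(a • z (r + 1) + β • z r)
  h₀_y : ∀ r, h₀ * y r - y r * h₀ = a • y r
  h₀_z : ∀ r, h₀ * z r - z r * h₀ = -(a • z r)
  u_one_v_zero : u 1 * v 0 - σ • (v 0 * u 1) = h₁
  u_zero_v_one : u 0 * v 1 - σ • (v 1 * u 0) = h₁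
  y_one_z_zero : y 1 * z 0 - τ • (z 0 * y 1) = g
  t_g : t * g = g * t
  u_y : ∀ r s, u (r + 1) * y s - y s * u (r + 1)
    = u r * y (s + 1) - y (s + 1) * u r + (a * κ) • (u r * y s + y s * u r)
  v_z : ∀ r s, v (r + 1) * z s - z s * v (r + 1)
    = v r * z (s + 1) - z (s + 1) * v r - (a * κ) • (v r * z s + z s * v r)
  u_z : ∀ r s, u r * z s = z s * u r
  v_y : ∀ r s, v r * y s = y s * v r

/-- The bracket of a derivation with a product, for a derivation given by a commutator. -/
theorem commutator_mul_sub_smul {τ : ℂ} {d y z y' z' : A} (hy : d * y - y * d = y')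
    (hz : d * z - z * d = z') :
    d * (y * z - τ • (z * y)) - (y * z - τ • (z * y)) * d
      = (y' * z - τ • (z * y')) + (y * z' - τ • (z' * y)) := by
  subst hy hz
  simp only [mul_sub, sub_mul, smul_mul_assoc, mul_smul_comm, mul_assoc]
  module

namespace CoupledModes

variable {σ τ a β θ κ : ℂ} {t h₀ h₁ g : A} {u v y z : ℕ → A}

theorem h₁_y (C : CoupledModes σ τ a β θ κ t h₀ h₁ g u v y z) (r : ℕ) :
    h₁ * y r - y r * h₁
      = a • y (r + 1) + (β + θ * a) • y r + (a * κ) • (h₀ * y r + y r * h₀) := by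
  have e := C.h₀_y r
  rw [C.h₁_eq]
  have e1 : h₀ * h₀ * y r - y r * (h₀ * h₀) = a • (h₀ * y r + y r * h₀) := by
    linear_combination (norm := skip) h₀ * e + e * h₀
    simp only [mul_sub, sub_mul, smul_mul_assoc, mul_smul_comm, mul_assoc]
    module
  linear_combination (norm := skip) C.t_y r + κ • e1 + θ • e
  simp only [mul_add, add_mul, smul_mul_assoc, mul_smul_comm, mul_assoc]
  module

theorem h₁_z (C : CoupledModes σ τ a β θ κ t h₀ h₁ g u v y z) (r : ℕ) :
    h₁ * z r - z r * h₁
      = -(a • z (r + 1) + (β + θ * a) • z r + (a * κ) • (h₀ * z r + z r * h₀)) := by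
  have e := C.h₀_z r
  rw [C.h₁_eq]
  have e1 : h₀ * h₀ * z r - z r * (h₀ * h₀) = -(a • (h₀ * z r + z r * h₀)) := by
    linear_combination (norm := skip) h₀ * e + e * h₀
    simp only [mul_sub, sub_mul, smul_mul_assoc, mul_smul_comm, mul_assoc, mul_neg, neg_mul]
    module
  linear_combination (norm := skip) C.t_z r + κ • e1 + θ • e
  simp only [mul_add, add_mul, smul_mul_assoc, mul_smul_comm, mul_assoc]
  module

theorem h₀_comm_bracket (C : CoupledModes σ τ a β θ κ t h₀ h₁ g u v y z) (r s : ℕ) :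
    h₀ * (y r * z s - τ • (z s * y r)) - (y r * z s - τ • (z s * y r)) * h₀ = 0 := by
  rw [commutator_mul_sub_smul (C.h₀_y r) (C.h₀_z s)]
  simp only [mul_neg, neg_mul, smul_mul_assoc, mul_smul_comm]
  module

theorem t_bracket (C : CoupledModes σ τ a β θ κ t h₀ h₁ g u v y z) (r s : ℕ) :
    t * (y r * z s - τ • (z s * y r)) - (y r * z s - τ • (z s * y r)) * t
      = a • ((y (r + 1) * z s - τ • (z s * y (r + 1)))
        - (y r * z (s + 1) - τ • (z (s + 1) * y r))) := by
  rw [commutator_mul_sub_smul (C.t_y r) (C.t_z s)]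
  simp only [mul_neg, neg_mul, smul_mul_assoc, mul_smul_comm, mul_add, add_mul]
  module

theorem h₁_bracket (C : CoupledModes σ τ a β θ κ t h₀ h₁ g u v y z) (r s : ℕ) :
    h₁ * (y r * z s - τ • (z s * y r)) - (y r * z s - τ • (z s * y r)) * h₁
      = a • ((y (r + 1) * z s - τ • (z s * y (r + 1)))
        - (y r * z (s + 1) - τ • (z (s + 1) * y r))) := by
  have e := C.h₀_comm_bracket r s
  have e' := C.t_bracket r s
  rw [C.h₁_eq]
  generalize y r * z s - τ • (z s * y r) = w at e e' ⊢
  linear_combination (norm := skip) e' + κ • (h₀ * e + e * h₀) + θ • e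
  simp only [mul_sub, sub_mul, smul_mul_assoc, mul_smul_comm, mul_add, add_mul, mul_assoc, mul_zero,
    zero_mul]
  module

theorem h₂_y (C : CoupledModes σ τ a β θ κ t h₀ h₁ g u v y z) (r : ℕ) :
    (u 1 * v 1 - σ • (v 1 * u 1)) * y r - y r * (u 1 * v 1 - σ • (v 1 * u 1))
      = h₁ * y (r + 1) - y (r + 1) * h₁ + (a * κ) • (h₁ * y r + y r * h₁) := by
  have e := C.u_y 0 r
  have f := C.v_y 1 r
  have f' := C.v_y 1 (r + 1)
  rw [← C.u_zero_v_one]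
  linear_combination (norm := skip) e * v 1 - σ • (v 1 * e) + u 1 * f - σ • (f * u 1)
    + σ • (f' * u 0) - u 0 * f' + (a * κ) • (-(σ • (f * u 0)) - u 0 * f)
  simp only [mul_sub, sub_mul, smul_mul_assoc, mul_smul_comm, mul_add, add_mul, mul_assoc]
  module

theorem h₂_z (C : CoupledModes σ τ a β θ κ t h₀ h₁ g u v y z) (r : ℕ) :
    (u 1 * v 1 - σ • (v 1 * u 1)) * z r - z r * (u 1 * v 1 - σ • (v 1 * u 1))
      = h₁ * z (r + 1) - z (r + 1) * h₁ - (a * κ) • (h₁ * z r + z r * h₁) := by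
  have e := C.v_z 0 r
  have f := C.u_z 1 r
  have f' := C.u_z 1 (r + 1)
  rw [← C.u_one_v_zero]
  linear_combination (norm := skip) u 1 * e - σ • (e * u 1) + f * v 1 - σ • (v 1 * f)
    + σ • (v 0 * f') - f' * v 0 + (-(a * κ)) • (σ • (v 0 * f) + f * v 0)
  simp only [mul_sub, sub_mul, smul_mul_assoc, mul_smul_comm, mul_add, add_mul, mul_assoc]
  module

theorem bracket_two_zero (C : CoupledModes σ τ a β θ κ t h₀ h₁ g u v y z) (ha : a ≠ 0) :
    y 2 * z 0 - τ • (z 0 * y 2) = y 1 * z 1 - τ • (z 1 * y 1) := by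
  have e := C.t_bracket 1 0
  rw [C.y_one_z_zero, C.t_g, sub_self] at e
  exact sub_eq_zero.1 ((smul_eq_zero.1 e.symm).resolve_left ha)

theorem bracket_three_zero (C : CoupledModes σ τ a β θ κ t h₀ h₁ g u v y z) (ha : a ≠ 0) :
    (y 3 * z 0 - τ • (z 0 * y 3)) - (y 2 * z 1 - τ • (z 1 * y 2))
      = (y 2 * z 1 - τ • (z 1 * y 2)) - (y 1 * z 2 - τ • (z 2 * y 1)) := by
  have e := C.t_bracket 2 0
  rw [C.bracket_two_zero ha, C.t_bracket 1 1] at e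
  exact (smul_right_injective A ha e).symm

theorem h₂_g (C : CoupledModes σ τ a β θ κ t h₀ h₁ g u v y z) (ha : a ≠ 0) :
    (u 1 * v 1 - σ • (v 1 * u 1)) * g - g * (u 1 * v 1 - σ • (v 1 * u 1))
      = (2 * a) • ((y 2 * z 1 - τ • (z 1 * y 2)) - (y 1 * z 2 - τ • (z 2 * y 1))) := by
  have e2 := C.bracket_two_zero ha
  have e3 := C.bracket_three_zero ha
  have e0 := C.h₀_comm_bracket 1 0
  have key := commutator_mul_sub_smul (τ := τ) (C.h₂_y 1) (C.h₂_z 0)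
  rw [C.y_one_z_zero] at key
  rw [key, C.h₁_y 2, C.h₁_z 1]
  have p1 := C.h₁_y 1
  have p2 := C.h₁_z 0
  have q1 := C.h₀_y 1
  have q2 := C.h₀_y 2
  have q3 := C.h₀_z 0
  have q4 := C.h₀_z 1
  simp only [zero_add, Nat.reduceAdd] at p1 p2 ⊢
  linear_combination (norm := skip) a • e3 + (β + θ * a) • e2 + (a * κ) ^ 2 • e0
    + (a * κ) • (p1 * z 0 + y 1 * p2 + τ • (p2 * y 1 + z 0 * p1))
    + (a * κ) • ((2 * τ) • (q3 * y 2) - q2 * z 0 + τ • (z 0 * q2) + (2 : ℂ) • (q1 * z 1)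
      + y 1 * q4 - τ • (q4 * y 1) + (2 : ℂ) • (h₀ * e2))
  simp only [mul_sub, sub_mul, smul_mul_assoc, mul_smul_comm, mul_add, add_mul, mul_assoc, mul_neg,
    neg_mul]
  module

theorem bracket_two_one_eq (C : CoupledModes σ τ a β θ κ t h₀ h₁ g u v y z) {β' θ' : ℂ}
    {t' g₀ : A} (C' : CoupledModes τ σ a β' θ' κ t' g₀ g h₁ y z u v) (ha : a ≠ 0) :
    (u 2 * v 1 - σ • (v 1 * u 2)) - (u 1 * v 2 - σ • (v 2 * u 1)) = 0 := by
  have e1 := C.h₂_g ha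
  have e2 := C.h₁_bracket 1 1
  have e3 := C'.h₂_g ha
  have e4 := C'.h₁_bracket 1 1
  simp only [Nat.reduceAdd] at e1 e2 e3 e4
  generalize (u 2 * v 1 - σ • (v 1 * u 2)) - (u 1 * v 2 - σ • (v 2 * u 1)) = P at *
  generalize (y 2 * z 1 - τ • (z 1 * y 2)) - (y 1 * z 2 - τ • (z 2 * y 1)) = G at *
  have e : (3 * a) • P = 0 := by
    linear_combination (norm := module) e1 + e4 - (2 : ℂ) • e2 - (2 : ℂ) • e3
  exact (smul_eq_zero.1 e).resolve_left (mul_ne_zero three_ne_zero ha)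

end CoupledModes

theorem commutator_transport {x : ℕ → A} {t t' : A} (htt : t * t' = t' * t) {k α γ : ℂ}
    (hk : k ≠ 0) (hx : ∀ r, t * x r - x r * t = k • x (r + 1))
    (h : t' * x 0 - x 0 * t' = α • x 1 + γ • x 0) (r : ℕ) :
    t' * x r - x r * t' = α • x (r + 1) + γ • x r := by
  induction r with
  | zero => exact h
  | succ r ih =>
    have e0 := hx r
    have e1 := hx (r + 1)
    apply smul_right_injective A hk
    linear_combination (norm := skip) e0 * t' - t' * e0 + t * ih - ih * t + α • e1 + γ • e0
      + x r * htt - htt * x r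
    simp only [mul_sub, sub_mul, smul_mul_assoc, mul_smul_comm, mul_add, add_mul, mul_assoc]
    module

/-- A doubly indexed family on which two commutators act by independent combinations of the two
shifts vanishes as soon as its first member does. -/
theorem family_eq_zero {W : ℕ → ℕ → A} {t t' : A} {p q ρ p' q' ρ' : ℂ}
    (ht : ∀ r s, t * W r s - W r s * t = p • W (r + 1) s + q • W r (s + 1) + ρ • W r s)
    (ht' : ∀ r s, t' * W r s - W r s * t' = p' • W (r + 1) s + q' • W r (s + 1) + ρ' • W r s)
    (hdet : p * q' - q * p' ≠ 0) (h : W 0 0 = 0) (r s : ℕ) : W r s = 0 := by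
  have step : ∀ r s, W r s = 0 → W (r + 1) s = 0 ∧ W r (s + 1) = 0 := by
    intro r s hW
    have e := ht r s
    have e' := ht' r s
    rw [hW, mul_zero, zero_mul, sub_self, smul_zero, add_zero] at e e'
    refine ⟨(smul_eq_zero.1 ?_).resolve_left hdet, (smul_eq_zero.1 ?_).resolve_left hdet⟩
    · linear_combination (norm := module) q • e' - q' • e
    · linear_combination (norm := module) p' • e - p • e'
  have base : ∀ s, W 0 s = 0 := fun s => by
    induction s with
    | zero => exact h
    | succ s ih => exact (step 0 s ih).2
  induction r with
  | zero => exact base s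
  | succ r ih => exact (step r s ih).1

section TwoSequences

variable {x y : ℕ → A} {t t' : A} {p q γ δ p' q' γ' δ' : ℂ}

theorem commutators_eq_zero (tx : ∀ r, t * x r - x r * t = p • x (r + 1) + γ • x r)
    (ty : ∀ r, t * y r - y r * t = q • y (r + 1) + δ • y r)
    (tx' : ∀ r, t' * x r - x r * t' = p' • x (r + 1) + γ' • x r)
    (ty' : ∀ r, t' * y r - y r * t' = q' • y (r + 1) + δ' • y r)
    (hdet : p * q' - q * p' ≠ 0) (h : x 0 * y 0 = y 0 * x 0) (r s : ℕ) :
    x r * y s = y s * x r := by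
  refine sub_eq_zero.1 (family_eq_zero (W := fun r s => x r * y s - y s * x r) (t := t) (t' := t')
    (ρ := γ + δ) (ρ' := γ' + δ') (fun r s => ?_) (fun r s => ?_) hdet (sub_eq_zero.2 h) r s)
  · have e := tx r
    have f := ty s
    linear_combination (norm := skip) e * y s - y s * e + x r * f - f * x r
    simp only [mul_sub, sub_mul, smul_mul_assoc, mul_smul_comm, mul_add, add_mul, mul_assoc]
    module
  · have e := tx' r
    have f := ty' s
    linear_combination (norm := skip) e * y s - y s * e + x r * f - f * x r
    simp only [mul_sub, sub_mul, smul_mul_assoc, mul_smul_comm, mul_add, add_mul, mul_assoc]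
    module

theorem exchange_relation (tx : ∀ r, t * x r - x r * t = p • x (r + 1) + γ • x r)
    (ty : ∀ r, t * y r - y r * t = q • y (r + 1) + δ • y r)
    (tx' : ∀ r, t' * x r - x r * t' = p' • x (r + 1) + γ' • x r)
    (ty' : ∀ r, t' * y r - y r * t' = q' • y (r + 1) + δ' • y r)
    (hdet : p * q' - q * p' ≠ 0) {k : ℂ}
    (h : x 1 * y 0 - y 0 * x 1 = x 0 * y 1 - y 1 * x 0 + k • (x 0 * y 0 + y 0 * x 0)) (r s : ℕ) :
    x (r + 1) * y s - y s * x (r + 1)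
      = x r * y (s + 1) - y (s + 1) * x r + k • (x r * y s + y s * x r) := by
  refine sub_eq_zero.1 (family_eq_zero (W := fun r s => x (r + 1) * y s - y s * x (r + 1)
      - (x r * y (s + 1) - y (s + 1) * x r + k • (x r * y s + y s * x r))) (t := t) (t' := t')
    (ρ := γ + δ) (ρ' := γ' + δ') (fun r s => ?_) (fun r s => ?_) hdet (sub_eq_zero.2 h) r s)
  · have e := tx r
    have e1 := tx (r + 1)
    have f := ty s
    have f1 := ty (s + 1)
    linear_combination (norm := skip) e1 * y s - y s * e1 + x (r + 1) * f - f * x (r + 1)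
      - (e * y (s + 1) - y (s + 1) * e + x r * f1 - f1 * x r)
      - k • (e * y s + y s * e + x r * f + f * x r)
    simp only [mul_sub, sub_mul, smul_mul_assoc, mul_smul_comm, mul_add, add_mul, mul_assoc]
    module
  · have e := tx' r
    have e1 := tx' (r + 1)
    have f := ty' s
    have f1 := ty' (s + 1)
    linear_combination (norm := skip) e1 * y s - y s * e1 + x (r + 1) * f - f * x (r + 1)
      - (e * y (s + 1) - y (s + 1) * e + x r * f1 - f1 * x r)
      - k • (e * y s + y s * e + x r * f + f * x r)
    simp only [mul_sub, sub_mul, smul_mul_assoc, mul_smul_comm, mul_add, add_mul, mul_assoc]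
    module

end TwoSequences

section CartanMatrix

variable {m n : ℕ} {i j : ZMod (m + n)}

theorem gpar_eq_zero_of_aZ_self (h : aZ m n i i = 2 ∨ aZ m n i i = -2) : gpar m n i = 0 := by
  have hp : ∀ k : ZMod (m + n), ppar m n k = 0 ∨ ppar m n k = 1 := fun k => by
    unfold ppar
    split_ifs <;> simp
  rcases hp i with h1 | h1 <;> rcases hp (i + 1) with h2 | h2 <;> simp_all [aZ, gpar]

theorem aZ_zero_zero (hm : 1 ≤ m) (hn : 1 ≤ n) : aZ m n 0 0 = 0 := by
  have : Fact (1 < m + n) := ⟨by omega⟩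
  simp [aZ, ppar, ZMod.val_one, hm]

theorem aZ_odd_odd (hm : 1 ≤ m) (hn : 2 ≤ n) : aZ m n m m = 0 := by
  have h1 : (m : ZMod (m + n)).val = m := ZMod.val_cast_of_lt (by omega)
  have h2 : ((m : ZMod (m + n)) + 1).val = m + 1 := by
    rw [← Nat.cast_succ]
    exact ZMod.val_cast_of_lt (by omega)
  simp [aZ, ppar, h1, h2, hm]

theorem one_ne_zero_zmod (h : 2 ≤ m + n) : (1 : ZMod (m + n)) ≠ 0 := by
  have : Fact (1 < m + n) := ⟨h⟩
  exact one_ne_zero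

theorem two_ne_zero_zmod (h : 3 ≤ m + n) : (2 : ZMod (m + n)) ≠ 0 := by
  intro h2
  have h3 : ((2 : ℕ) : ZMod (m + n)) = 0 := by exact_mod_cast h2
  have := Nat.le_of_dvd two_pos ((ZMod.natCast_eq_zero_iff _ _).1 h3)
  omega

theorem aZ_comm (h : 3 ≤ m + n) : aZ m n i j = aZ m n j i := by
  have h1 := two_ne_zero_zmod h
  by_cases hij : i = j
  · rw [hij]
  by_cases h2 : j = i + 1
  · subst h2
    have h3 : i ≠ i + 1 + 1 := fun e => h1 (by linear_combination -e)
    simp [aZ, hij, Ne.symm hij, h3]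
  by_cases h3 : j = i - 1
  · subst h3
    simp [aZ, hij, Ne.symm hij, h2]
  · have h4 : i ≠ j + 1 := fun e => h3 (by rw [e]; ring)
    have h5 : i ≠ j - 1 := fun e => h2 (by rw [e]; ring)
    simp [aZ, hij, Ne.symm hij, h2, h3, h4, h5]

theorem bC_self_s8 (h : 2 ≤ m + n) (hi : i ≠ 0) : bC m n i i = 0 := by
  have h1 := one_ne_zero_zmod h
  have h2 : i ≠ i - 1 := fun e => h1 (by linear_combination e)
  simp [bC, hi, h1, h2]

end CartanMatrix

theorem sgn_true : sgn true = 1 := by simp [sgn]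

theorem sgn_false : sgn false = -1 := by simp [sgn]

theorem sgn_ne_zero (b : Bool) : sgn b ≠ 0 := by
  cases b <;> simp [sgn]

theorem sbr_zero_left (p : ℕ) (x y : A) : sbr 0 p x y = x * y - y * x := by
  simp [sbr]

theorem sbr_zero_right (p : ℕ) (x y : A) : sbr p 0 x y = x * y - y * x := by
  simp [sbr]

/-- The modes generated from `x` by repeatedly applying the commutator with `t`, divided by `k`. -/
def adModes (k : ℂ) (t x : A) : ℕ → A
  | 0 => x
  | r + 1 => k⁻¹ • (t * adModes k t x r - adModes k t x r * t)

theorem commutator_adModes {k : ℂ} (hk : k ≠ 0) (t x : A) (r : ℕ) :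
    t * adModes k t x r - adModes k t x r * t = k • adModes k t x (r + 1) := by
  rw [adModes, smul_inv_smul₀ hk]

namespace YtildeRep

variable {m n : ℕ} {ε₁ ε₂ : ℂ} (R : YtildeRep m n ε₁ ε₂ A) (i j : ZMod (m + n))

theorem H_mul_htld {r : ℕ} (hr : r ≤ 1) :
    R.H i r * htld m n ε₁ ε₂ R.H j = htld m n ε₁ ε₂ R.H j * R.H i r := by
  have h0 : Commute (R.H i r) (R.H j 0) := R.rel21 i j r 0 hr zero_le_one
  have h1 : Commute (R.H i r) (R.H j 1) := R.rel21 i j r 1 hr le_rfl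
  exact h1.sub_right ((h0.mul_right h0).smul_right _)

theorem htld_mul_htld :
    htld m n ε₁ ε₂ R.H i * htld m n ε₁ ε₂ R.H j = htld m n ε₁ ε₂ R.H j * htld m n ε₁ ε₂ R.H i := by
  have h0 : Commute (R.H i 0) (htld m n ε₁ ε₂ R.H j) := R.H_mul_htld i j zero_le_one
  have h1 : Commute (R.H i 1) (htld m n ε₁ ε₂ R.H j) := R.H_mul_htld i j le_rfl
  exact h1.sub_left ((h0.mul_left h0).smul_left _)

variable {i}

theorem htld_X_self (hmn : 2 ≤ m + n) (hi : i ≠ 0) (him : i ≠ (m : ZMod (m + n)))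
    (ha : aC m n i i ≠ 0) (b : Bool) (r : ℕ) :
    htld m n ε₁ ε₂ R.H i * R.X b i r - R.X b i r * htld m n ε₁ ε₂ R.H i
      = (sgn b * aC m n i i) • R.X b i (r + 1) := by
  rcases Nat.eq_zero_or_pos r with rfl | hr
  · rw [R.rel25, bC_self_s8 hmn hi, zero_mul, zero_smul, sub_zero]
  · have hs : sgn b * (sgn b * (aC m n i i)⁻¹ * aC m n i i) = 1 := by
      rw [mul_assoc, inv_mul_cancel₀ ha]
      cases b <;> simp [sgn]
    have hs' : sgn b * aC m n i i * (sgn b * (aC m n i i)⁻¹) = 1 := by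
      rw [← hs]
      ring
    rw [R.recX b i r hr, if_neg (by tauto), smul_smul, hs', one_smul]

end YtildeRep

theorem affine_super_yangian_stmt8
    (m n : ℕ) (hm : 2 ≤ m) (hn : 2 ≤ n) (hmn : m ≠ n) (ε₁ ε₂ : ℂ)
    (B : Type*) [Ring B] [Algebra ℂ B] (R : YtildeRep m n ε₁ ε₂ B)
    (i j : ZMod (m + n))
    (hij : (aZ m n i i = 2 ∧ aZ m n i j = -1) ∨ (aZ m n i i = -2 ∧ aZ m n i j = 1)) :
    R.H i 2 * R.H i 1 = R.H i 1 * R.H i 2 := by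
  have hpar : gpar m n i = 0 := gpar_eq_zero_of_aZ_self (hij.imp And.left And.left)
  have hne : i ≠ j := by
    rintro rfl
    omega
  have hi0 : i ≠ 0 := by
    rintro rfl
    rw [aZ_zero_zero (by omega) (by omega)] at hij
    omega
  have him : i ≠ (m : ZMod (m + n)) := by
    rintro rfl
    rw [aZ_odd_odd (by omega) hn] at hij
    omega
  have hdetZ : aZ m n i i * aZ m n j j - aZ m n i j * aZ m n i j ≠ 0 := by
    rcases hij with ⟨h1, h2⟩ | ⟨h1, h2⟩ <;> rw [h1, h2] <;> omega
  have hs0 : aC m n i i ≠ 0 := by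
    rw [aC, Int.cast_ne_zero]
    omega
  have ha0 : aC m n i j ≠ 0 := by
    rw [aC, Int.cast_ne_zero]
    omega
  have hsymm : aC m n j i = aC m n i j := by rw [aC, aC, aZ_comm (by omega)]
  have hdet : aC m n i i * aC m n j j - aC m n i j * aC m n i j ≠ 0 := by
    unfold aC
    exact_mod_cast hdetZ
  have tiX := R.htld_X_self (by omega) hi0 him hs0
  have titj := R.htld_mul_htld i j
  have tihi := R.H_mul_htld i i zero_le_one
  have tihj := R.H_mul_htld j i zero_le_one
  have tjX0 := fun b => R.rel25 b j i
  have tjY0 := fun b => R.rel25 b j j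
  have tiY0 := fun b => R.rel25 b i j
  have hti : htld m n ε₁ ε₂ R.H i = R.H i 1 - ((ε₁ + ε₂) / 2) • (R.H i 0 * R.H i 0) := rfl
  have htj : htld m n ε₁ ε₂ R.H j = R.H j 1 - ((ε₁ + ε₂) / 2) • (R.H j 0 * R.H j 0) := rfl
  have tihi1 := R.H_mul_htld i i le_rfl
  have tjhi1 := R.H_mul_htld i j le_rfl
  have tihj1 := R.H_mul_htld j i le_rfl
  have hiX0 := fun b => R.rel24 b i i 0 zero_le_one
  have hiY0 := fun b => R.rel24 b i j 0 zero_le_one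
  have hjX0 := fun b => R.rel24 b j i 0 zero_le_one
  have E0 := fun b => R.rel26 b i j
  have F0 := R.rel22 i j
  have F0' := R.rel22 j i
  have Hi1 := R.rel23a i i
  have Hi1' := R.rel23b i i
  have Hj0 := R.rel22 j j
  have Hj1 := R.rel23a j j
  have Hj1' := R.rel23b j j
  have Hi2 := R.recH i 1 le_rfl
  simp only [hpar, sbr_zero_left, sbr_zero_right, if_true, if_neg hne, if_neg hne.symm, hsymm,
    sub_eq_zero, Nat.reduceAdd, acm] at *
  generalize htld m n ε₁ ε₂ R.H i = ti at *
  generalize htld m n ε₁ ε₂ R.H j = tj at *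
  generalize aC m n i i = s at *
  generalize aC m n i j = a at *
  generalize aC m n j j = d at *
  generalize bC m n i j = bij at *
  generalize bC m n j i = bji at *
  generalize bC m n j j = bjj at *
  generalize (ε₁ + ε₂) / 2 = κ at *
  generalize (ε₁ - ε₂) / 2 = c at *
  have hsgn := sgn_ne_zero
  have hsa : ∀ b, sgn b * a ≠ 0 := fun b => mul_ne_zero (hsgn b) ha0
  have hss : ∀ b, sgn b * s ≠ 0 := fun b => mul_ne_zero (hsgn b) hs0
  have tiY : ∀ b r, _ := fun b => commutator_adModes (hsa b) ti (R.X b j 0)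
  have hY0 : ∀ b, adModes (sgn b * a) ti (R.X b j 0) 0 = R.X b j 0 := fun _ => rfl
  have hY1 : ∀ b, adModes (sgn b * a) ti (R.X b j 0) 1 = R.X b j 1 - (bij * c) • R.X b j 0 :=
    fun b => by
      have e := tiY b 0
      rw [hY0, tiY0 b] at e
      exact (smul_right_injective B (hsa b) e).symm
  generalize hY : (fun b => adModes (sgn b * a) ti (R.X b j 0)) = Y at *
  have hY' : ∀ b, adModes (sgn b * a) ti (R.X b j 0) = Y b := fun b => congrFun hY b
  simp only [hY'] at *
  have tjX : ∀ b r, tj * R.X b i r - R.X b i r * tj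
      = (sgn b * a) • R.X b i (r + 1) + (-(sgn b * a * bji * c)) • R.X b i r := fun b =>
    commutator_transport titj (hss b) (tiX b) (by
      linear_combination (norm := module) tjX0 b)
  have tjY : ∀ b r, tj * Y b r - Y b r * tj
      = (sgn b * d) • Y b (r + 1) + (sgn b * d * (bij - bjj) * c) • Y b r := fun b =>
    commutator_transport titj (hsa b) (tiY b) (by
      rw [hY0, hY1]
      linear_combination (norm := module) tjY0 b)
  have hiX : ∀ b r, R.H i 0 * R.X b i r - R.X b i r * R.H i 0
      = (0 : ℂ) • R.X b i (r + 1) + (sgn b * s) • R.X b i r := fun b =>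
    commutator_transport tihi.symm (hss b) (tiX b) (by
      rw [hiX0 b, zero_smul, zero_add])
  have hjX : ∀ b r, R.H j 0 * R.X b i r - R.X b i r * R.H j 0
      = (0 : ℂ) • R.X b i (r + 1) + (sgn b * a) • R.X b i r := fun b =>
    commutator_transport tihj.symm (hss b) (tiX b) (by
      rw [hjX0 b, zero_smul, zero_add])
  have hiY : ∀ b r, R.H i 0 * Y b r - Y b r * R.H i 0
      = (0 : ℂ) • Y b (r + 1) + (sgn b * a) • Y b r := fun b =>
    commutator_transport tihi.symm (hsa b) (tiY b) (by
      rw [hY0, hiY0 b, zero_smul, zero_add])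
  simp only [zero_smul, zero_add] at hiX hjX hiY
  have tiX' : ∀ b r, ti * R.X b i r - R.X b i r * ti
      = (sgn b * s) • R.X b i (r + 1) + (0 : ℂ) • R.X b i r := fun b r => by
    rw [tiX, zero_smul, add_zero]
  have tiY' : ∀ b r, ti * Y b r - Y b r * ti
      = (sgn b * a) • Y b (r + 1) + (0 : ℂ) • Y b r := fun b r => by
    rw [tiY, zero_smul, add_zero]
  have hdet' : ∀ b b', sgn b * s * (sgn b' * d) - sgn b' * a * (sgn b * a) ≠ 0 := fun b b' => by
    have e : sgn b * s * (sgn b' * d) - sgn b' * a * (sgn b * a)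
        = sgn b * sgn b' * (s * d - a * a) := by ring
    rw [e]
    exact mul_ne_zero (mul_ne_zero (hsgn b) (hsgn b')) hdet
  have E : ∀ b r k, R.X b i (r + 1) * Y b k - Y b k * R.X b i (r + 1)
      = R.X b i r * Y b (k + 1) - Y b (k + 1) * R.X b i r
        + (sgn b * a * κ) • (R.X b i r * Y b k + Y b k * R.X b i r) := fun b =>
    exchange_relation (tiX' b) (tiY' b) (tjX b) (tjY b) (hdet' b b) (by
      rw [hY0, hY1]
      linear_combination (norm := skip) E0 b
      simp only [mul_sub, sub_mul, smul_mul_assoc, mul_smul_comm]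
      module)
  have Fuz : ∀ r k, R.X true i r * Y false k = Y false k * R.X true i r :=
    commutators_eq_zero (tiX' true) (tiY' false) (tjX true) (tjY false) (hdet' _ _) (by
      rw [hY0, F0])
  have Fvy : ∀ r k, R.X false i r * Y true k = Y true k * R.X false i r :=
    commutators_eq_zero (tiX' false) (tiY' true) (tjX false) (tjY true) (hdet' _ _) (by
      rw [hY0, F0'])
  simp only [sbr] at Hj0 Hj1 Hj1'
  generalize (-1 : ℂ) ^ (gpar m n j * gpar m n j) = τ at *
  have g1 : Y true 1 * Y false 0 - τ • (Y false 0 * Y true 1)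
      = R.H j 1 - (bij * c) • R.H j 0 := by
    rw [hY0, hY1, ← Hj1, ← Hj0]
    simp only [mul_sub, sub_mul, smul_mul_assoc, mul_smul_comm]
    module
  have g2 : Y true 0 * Y false 1 - τ • (Y false 1 * Y true 0)
      = R.H j 1 - (bij * c) • R.H j 0 := by
    rw [hY0, hY1, ← Hj1', ← Hj0]
    simp only [mul_sub, sub_mul, smul_mul_assoc, mul_smul_comm]
    module
  have C : CoupledModes 1 τ a 0 0 κ ti (R.H i 0) (R.H i 1) (R.H j 1 - (bij * c) • R.H j 0)
      (R.X true i) (R.X false i) (Y true) (Y false) := by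
    refine ⟨?_, fun r => ?_, fun r => ?_, fun r => ?_, fun r => ?_, ?_, ?_, g1, ?_, fun r k => ?_,
      fun r k => ?_, Fuz, Fvy⟩
    · rw [hti]
      module
    · linear_combination (norm := (simp only [sgn_true]; module)) tiY true r
    · linear_combination (norm := (simp only [sgn_false]; module)) tiY false r
    · linear_combination (norm := (simp only [sgn_true]; module)) hiY true r
    · linear_combination (norm := (simp only [sgn_false]; module)) hiY false r
    · rw [one_smul, Hi1]
    · rw [one_smul, Hi1']
    · rw [mul_sub, sub_mul, tihj1, mul_smul_comm, smul_mul_assoc, tihj]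
    · linear_combination (norm := (simp only [sgn_true]; module)) E true r k
    · linear_combination (norm := (simp only [sgn_false]; module)) E false r k
  have C' : CoupledModes τ 1 a (-(a * bji * c)) (-(bij * c)) κ tj (R.H j 0)
      (R.H j 1 - (bij * c) • R.H j 0) (R.H i 1)
      (Y true) (Y false) (R.X true i) (R.X false i) := by
    refine ⟨?_, fun r => ?_, fun r => ?_, fun r => ?_, fun r => ?_, g1, g2, ?_, tjhi1.symm,
      fun r k => ?_, fun r k => ?_, fun r k => (Fvy k r).symm, fun r k => (Fuz k r).symm⟩
    · rw [htj]
      module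
    · linear_combination (norm := (simp only [sgn_true]; module)) tjX true r
    · linear_combination (norm := (simp only [sgn_false]; module)) tjX false r
    · linear_combination (norm := (simp only [sgn_true]; module)) hjX true r
    · linear_combination (norm := (simp only [sgn_false]; module)) hjX false r
    · rw [one_smul, Hi1]
    · linear_combination (norm := (simp only [sgn_true]; module)) E true k r
    · linear_combination (norm := (simp only [sgn_false]; module)) E false k r
  have hP := C.bracket_two_one_eq C' ha0
  have D : ∀ r k, ti * (R.X true i r * R.X false i k - R.X false i k * R.X true i r)
      - (R.X true i r * R.X false i k - R.X false i k * R.X true i r) * ti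
      = s • ((R.X true i (r + 1) * R.X false i k - R.X false i k * R.X true i (r + 1))
        - (R.X true i r * R.X false i (k + 1) - R.X false i (k + 1) * R.X true i r)) :=
    fun r k => by
      have e := commutator_mul_sub_smul (τ := 1) (tiX true r) (tiX false k)
      simp only [one_smul] at e
      rw [e]
      simp only [sgn_true, sgn_false, smul_mul_assoc, mul_smul_comm]
      module
  have D₀ : ∀ r k, R.H i 0 * (R.X true i r * R.X false i k - R.X false i k * R.X true i r)
      = (R.X true i r * R.X false i k - R.X false i k * R.X true i r) * R.H i 0 :=
    fun r k => by
      have e := commutator_mul_sub_smul (τ := 1) (hiX true r) (hiX false k)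
      simp only [one_smul] at e
      rw [← sub_eq_zero, e]
      simp only [sgn_true, sgn_false, smul_mul_assoc, mul_smul_comm]
      module
  have H2 : R.H i 2 = R.X true i 1 * R.X false i 1 - R.X false i 1 * R.X true i 1 := by
    have e := D 1 0
    rw [Hi1, sub_eq_zero.mpr tihi1.symm, ← Hi2] at e
    exact sub_eq_zero.mp ((smul_eq_zero.mp e.symm).resolve_left hs0)
  have c1 : Commute ti (R.H i 2) := by
    have e := D 1 1
    simp only [one_smul] at hP
    rw [hP, smul_zero, ← H2] at e
    exact sub_eq_zero.mp e
  have c0 : Commute (R.H i 0) (R.H i 2) := by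
    rw [H2]
    exact D₀ 1 1
  have hH1 : R.H i 1 = ti + κ • (R.H i 0 * R.H i 0) := by
    rw [hti, sub_add_cancel]
  rw [hH1]
  exact (c1.add_left ((c0.mul_left c0).smul_left κ)).symm

end
end
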